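/- Let p be a prime, R = 𝓞 ⊗_ℤ ℤ_p with involution σ_R = σ ⊗ id, and let g be a 4×4 matrix over R, invertible over R, such that σ_R(g)ᵀ·J·g = λ·J for some unit λ of ℤ_p (viewed in R). Then there exist a 4×4 matrix h over R, invertible over R, a unit μ of ℤ_p, and a unit α ∈ R^×, such that σ_R(h)ᵀ·J·h = μ·J, det(h) = μ², and g = h·r_α. Equivalently, det(g)/λ² = α·σ_R(α)⁻¹ for some α ∈ R^×. -/

import Mathlib

set_option synthInstance.maxHeartbeats 1000000
set_option maxHeartbeats 1000000

open Matrix NumberField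
open scoped TensorProduct

noncomputable section

/-- The matrix `J = [[0, −1₂], [1₂, 0]]` in 2×2 block form, over a ring `R`. -/
def J4 (R : Type*) [Ring R] : Matrix (Fin 2 ⊕ Fin 2) (Fin 2 ⊕ Fin 2) R :=
  Matrix.fromBlocks 0 (-1) 1 0

/-- The involution `σ_R = σ ⊗ id` of `R = 𝓞 ⊗_ℤ ℤ_p`. -/
def sigmaR (K : Type*) [Field K] [NumberField K]
    (σO : (𝓞 K) ≃+* (𝓞 K)) (p : ℕ) [Fact p.Prime] :
    (𝓞 K) ⊗[ℤ] ℤ_[p] →ₐ[ℤ] (𝓞 K) ⊗[ℤ] ℤ_[p] :=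
  Algebra.TensorProduct.map ((σO : (𝓞 K) →+* (𝓞 K)).toIntAlgHom) (AlgHom.id ℤ ℤ_[p])

/-- The inclusion `ℤ_p → 𝓞 ⊗_ℤ ℤ_p` ("viewed in `R`"). -/
def iotaR (K : Type*) [Field K] [NumberField K] (p : ℕ) [Fact p.Prime] :
    ℤ_[p] →ₐ[ℤ] (𝓞 K) ⊗[ℤ] ℤ_[p] :=
  Algebra.TensorProduct.includeRight

/-- `r_α = diag(1, α, 1, σ_R(α)⁻¹)` for a unit `α` of `R = 𝓞 ⊗_ℤ ℤ_p`. -/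
def rAlpha (K : Type*) [Field K] [NumberField K]
    (σO : (𝓞 K) ≃+* (𝓞 K)) (p : ℕ) [Fact p.Prime]
    (α : ((𝓞 K) ⊗[ℤ] ℤ_[p])ˣ) :
    Matrix (Fin 2 ⊕ Fin 2) (Fin 2 ⊕ Fin 2) ((𝓞 K) ⊗[ℤ] ℤ_[p]) :=
  Matrix.fromBlocks (Matrix.diagonal ![1, (α : (𝓞 K) ⊗[ℤ] ℤ_[p])]) 0 0
    (Matrix.diagonal ![1, sigmaR K σO p ((α⁻¹ : ((𝓞 K) ⊗[ℤ] ℤ_[p])ˣ) : (𝓞 K) ⊗[ℤ] ℤ_[p])])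

section abs
variable {R : Type*} [CommRing R] (s : R →+* R)

/-- fixed elements, unramified case -/
theorem aux_unram (hs : ∀ x, s (s x) = x)
    (hloc : ∀ x y, s x = x → s y = y → IsUnit (x + y) → IsUnit x ∨ IsUnit y)
    (θ : R) (hθ : IsUnit (s θ - θ)) (u : R) (hu : u * s u = 1) :
    ∃ α, IsUnit α ∧ α = u * s α := by
  by_contra hcon
  push Not at hcon
  have key : ∀ x, ¬ IsUnit (x + u * s x) := by
    intro x hx
    refine hcon _ hx ?_
    rw [map_add, map_mul, hs]
    linear_combination (-x) * hu
  have h1 := key 1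
  have h2 := key θ
  have hN : IsUnit ((s θ - θ) * s (s θ - θ)) := hθ.mul (hθ.map s)
  set a := (1 : R) + u * s 1 with ha
  set b := θ + u * s θ with hb
  have hsa : s a * u = a := by
    rw [ha, map_add, map_mul, hs, map_one]; linear_combination hu
  have hsb : s b * u = b := by
    rw [hb, map_add, map_mul, hs]; linear_combination θ * hu
  have hE : (s θ - θ) * s (s θ - θ) =
      (b * s b + (θ * s θ) * (a * s a)) + (-(θ + s θ) * (b * s a)) := by
    have e1 : b * s a = s b * a := by linear_combination (s b) * hsa - s a * hsb
    have e2 : s θ - θ = s θ * a - b := by rw [ha, hb, map_one]; ring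
    have e3 : s (s θ - θ) = θ * s a - s b := by rw [e2, map_sub, map_mul, hs]
    rw [e3, e2]; linear_combination (s θ) * e1
  have e1 : b * s a = s b * a := by linear_combination (s b) * hsa - s a * hsb
  rw [hE] at hN
  have f1 : s (b * s b) = b * s b := by rw [map_mul, hs]; ring
  have f2 : s ((θ * s θ) * (a * s a)) = (θ * s θ) * (a * s a) := by
    simp only [map_mul, hs]; ring
  have f3 : s (-(θ + s θ) * (b * s a)) = -(θ + s θ) * (b * s a) := by
    simp only [map_mul, map_neg, map_add, hs]; linear_combination (θ + s θ) * e1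
  rcases hloc _ _ (by rw [map_add, f1, f2]) f3 hN with h | h
  · rcases hloc _ _ f1 f2 h with h | h
    · exact h2 (isUnit_of_mul_isUnit_left h)
    · exact h1 (isUnit_of_mul_isUnit_left (isUnit_of_mul_isUnit_right h))
  · exact h2 (isUnit_of_mul_isUnit_left (isUnit_of_mul_isUnit_right h))

theorem aux_max (hs : ∀ x, s (s x) = x)
    (hloc : ∀ x y, s x = x → s y = y → IsUnit (x + y) → IsUnit x ∨ IsUnit y)
    (Q : Ideal R) (hQ : Q.IsMaximal) (hsQ : ∀ x, s x - x ∈ Q) (m : R) (hm : m ∉ Q) :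
    IsUnit m := by
  have hz : m * s m ∉ Q := by
    intro h
    rcases hQ.isPrime.mem_or_mem h with h | h
    · exact hm h
    · exact hm (by simpa using Q.sub_mem h (hsQ m))
  have hzf : s (m * s m) = m * s m := by rw [map_mul, hs]; ring
  obtain ⟨w, i, hi, hw⟩ := hQ.exists_inv hz
  set z := m * s m with hzd
  have hiw : i = 1 - w * z := by linear_combination hw
  have hsi : s i = 1 - s w * z := by rw [hiw, map_sub, map_mul, hzf, map_one]
  have : IsUnit (i * s i + z * (w + s w - z * (w * s w))) := by
    have : i * s i + z * (w + s w - z * (w * s w)) = 1 := by rw [hsi, hiw]; ring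
    rw [this]; exact isUnit_one
  rcases hloc _ _ (by rw [map_mul, hs]; ring)
    (by simp only [map_mul, map_sub, map_add, hs, hzf]; ring) this with h | h
  · exact absurd (Ideal.eq_top_of_isUnit_mem _ (Q.mul_mem_right _ hi) h) hQ.ne_top
  · exact isUnit_of_mul_isUnit_left (isUnit_of_mul_isUnit_left h)

/-- Jacobi complementary minor. -/
theorem aux_jac
    (g : Matrix (Fin 2 ⊕ Fin 2) (Fin 2 ⊕ Fin 2) R) (l : R) (hl : IsUnit l)
    (hrel : (g.map s)ᵀ * J4 R * g = l • J4 R) :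
    g.det * s (g.toBlocks₁₁.det) = l ^ 2 * g.toBlocks₁₁.det := by
  obtain ⟨l, rfl⟩ := hl
  obtain ⟨A, B, C, D, rfl⟩ : ∃ A B C D, g = fromBlocks A B C D :=
    ⟨_, _, _, _, (fromBlocks_toBlocks g).symm⟩
  rw [toBlocks_fromBlocks₁₁]
  have hJ : J4 R * J4 R = -1 := by
    simp [J4, fromBlocks_multiply, ← fromBlocks_one, fromBlocks_neg]
  have h1 : ((↑l⁻¹ : R) • (-(J4 R) * ((fromBlocks A B C D).map s)ᵀ * J4 R)) *
      fromBlocks A B C D = 1 := by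
    rw [smul_mul_assoc, mul_assoc, mul_assoc, ← mul_assoc _ (J4 R), hrel, mul_smul_comm,
      neg_mul, hJ, smul_smul]
    simp
  have h2 := mul_eq_one_comm.mp h1
  rw [mul_smul_comm] at h2
  have h3 : fromBlocks A B C D * (-(J4 R) * ((fromBlocks A B C D).map s)ᵀ * J4 R) =
      (l : R) • 1 := by
    rw [← h2, smul_smul]; simp
  simp only [J4, fromBlocks_map, fromBlocks_transpose, fromBlocks_neg, fromBlocks_multiply,
    ← fromBlocks_one, fromBlocks_smul, fromBlocks_inj] at h3
  obtain ⟨-, h4, -, h5⟩ := h3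
  have h6 : fromBlocks A B C D * fromBlocks 1 (-(B.map s)ᵀ) 0 (A.map s)ᵀ =
      fromBlocks A 0 C ((l : R) • 1) := by
    rw [fromBlocks_multiply]
    congr 1
    · simp
    · rw [← smul_zero (l : R), ← h4]; simp
    · simp
    · rw [← h5]; simp
  have h7 := congrArg det h6
  rw [det_mul, det_fromBlocks_zero₂₁, det_fromBlocks_zero₁₂, det_one, one_mul, det_transpose,
    det_smul, det_one] at h7
  have : (A.map s).det = s A.det := (RingHom.map_det s A).symm
  rw [this] at h7
  rw [h7]; simp; ring

/-- partial swaps -/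
def sw (R : Type*) [CommRing R] (i : Fin 2) : Matrix (Fin 2 ⊕ Fin 2) (Fin 2 ⊕ Fin 2) R :=
  fromBlocks (diagonal fun j => if j = i then 0 else 1) (diagonal fun j => if j = i then -1 else 0)
   (diagonal fun j => if j = i then 1 else 0) (diagonal fun j => if j = i then 0 else 1)

theorem sw_rel (i : Fin 2) : ((sw R i).map s)ᵀ * J4 R * sw R i = J4 R := by
  simp only [sw, J4, fromBlocks_map, fromBlocks_transpose, fromBlocks_multiply, ← diagonal_one,
    ← diagonal_zero, diagonal_map, diagonal_transpose, diagonal_mul_diagonal,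
    diagonal_add, map_zero]
  congr 1 <;> · ext j k; fin_cases i <;> fin_cases j <;> fin_cases k <;> simp

theorem sw_det (i : Fin 2) : (sw R i).det = 1 := by
  have : sw R i = fromBlocks 1 (diagonal fun j => if j = i then -1 else 0) 0 1 *
    fromBlocks 1 0 (diagonal fun j => if j = i then 1 else 0) 1 *
    fromBlocks 1 (diagonal fun j => if j = i then -1 else 0) 0 1 := by
    simp only [sw, fromBlocks_multiply, ← diagonal_one,
    ← diagonal_zero, diagonal_mul_diagonal, diagonal_add]
    congr 2 <;> · ext j; by_cases h : j = i <;> simp [h]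
  rw [this, det_mul, det_mul]; simp

theorem sw_jac (i : Fin 2)
    (g : Matrix (Fin 2 ⊕ Fin 2) (Fin 2 ⊕ Fin 2) R) (l : R)
    (hrel : (g.map s)ᵀ * J4 R * g = l • J4 R) :
    ((sw R i * g).map s)ᵀ * J4 R * (sw R i * g) = l • J4 R := by
  rw [Matrix.map_mul, transpose_mul, ← hrel]
  conv_rhs => rw [← sw_rel s i]
  simp only [mul_assoc]

/-- symplectic over a field -/
theorem aux_field {F : Type*} [Field F] (g : Matrix (Fin 2 ⊕ Fin 2) (Fin 2 ⊕ Fin 2) F)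
    (hg : IsUnit g.det) (l : F) (hrel : gᵀ * J4 F * g = l • J4 F) :
    g.toBlocks₁₁.det ≠ 0 ∨ (sw F 0 * g).toBlocks₁₁.det ≠ 0 ∨ (sw F 1 * g).toBlocks₁₁.det ≠ 0 ∨
      (sw F 0 * (sw F 1 * g)).toBlocks₁₁.det ≠ 0 := by
  by_contra! hcon
  obtain ⟨h1, h2, h3, h4⟩ := hcon
  have hsy := congrFun (congrFun hrel (Sum.inl 0)) (Sum.inl 1)
  simp [J4, Matrix.mul_apply, Fin.sum_univ_two] at hsy
  simp [sw, Matrix.mul_apply, det_fin_two, toBlocks₁₁, Fin.sum_univ_two, diagonal_apply] at h1 h2 h3 h4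
  have hab : (g (.inl 0) (.inl 0) * g (.inr 0) (.inl 1) - g (.inl 0) (.inl 1) * g (.inr 0) (.inl 0)) = 0 := by
    apply pow_eq_zero_iff (two_ne_zero) |>.mp
    generalize g (.inl 0) (.inl 0) = a0 at *
    generalize g (.inl 0) (.inl 1) = a1 at *
    generalize g (.inl 1) (.inl 0) = b0 at *
    generalize g (.inl 1) (.inl 1) = b1 at *
    generalize g (.inr 0) (.inl 0) = c0 at *
    generalize g (.inr 0) (.inl 1) = c1 at *
    generalize g (.inr 1) (.inl 0) = d0 at *
    generalize g (.inr 1) (.inl 1) = d1 at *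
    clear hrel hg
    grind
  have hP : ∀ i j, g i (.inl 0) * g j (.inl 1) - g i (.inl 1) * g j (.inl 0) = 0 := by
    intro i j
    rcases i with i | i <;> rcases j with j | j <;> fin_cases i <;> fin_cases j <;> 
      simp only [Fin.zero_eta, Fin.mk_one] <;> clear hrel hg <;> grind
  have hv : ∀ v : Fin 2 ⊕ Fin 2 → F, g *ᵥ v = 0 → v = 0 := fun v hv =>
    Matrix.eq_zero_of_mulVec_eq_zero hg.ne_zero hv
  have hz : ∀ i, g i (.inl 0) = 0 := by
    intro i
    have := congrFun (hv (Sum.elim ![- g i (.inl 1), g i (.inl 0)] 0) (by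
      ext j
      simp [Matrix.mulVec, dotProduct, Fin.sum_univ_two]
      linear_combination hP i j)) (.inl 1)
    simpa using this
  have := congrFun (hv (Sum.elim ![1, 0] 0) (by
      ext j
      simp [Matrix.mulVec, dotProduct, Fin.sum_univ_two, hz])) (.inl 0)
  simp at this

theorem aux_main (hs : ∀ x, s (s x) = x)
    (hloc : ∀ x y, s x = x → s y = y → IsUnit (x + y) → IsUnit x ∨ IsUnit y)
    (θ : R) (hθ : ∀ x, ∃ c, s x - x = c * (s θ - θ))
    (g : Matrix (Fin 2 ⊕ Fin 2) (Fin 2 ⊕ Fin 2) R) (hg : IsUnit g.det)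
    (l : R) (hl : IsUnit l) (hsl : s l = l)
    (hrel : (g.map s)ᵀ * J4 R * g = l • J4 R) :
    ∃ α : Rˣ, g.det * s α = l ^ 2 * α := by
  by_cases hun : IsUnit (s θ - θ)
  · have hdJ : IsUnit (J4 R).det := by
      have hJ : J4 R * J4 R = -1 := by
        simp [J4, fromBlocks_multiply, ← fromBlocks_one, fromBlocks_neg]
      have := congrArg det hJ
      rw [det_mul] at this
      refine IsUnit.of_mul_eq_one ((J4 R).det) ?_
      rw [this, det_neg]; norm_num
    have hd := congrArg det hrel
    rw [det_mul, det_mul, det_transpose, det_smul] at hd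
    have hgs : (g.map s).det = s g.det := (RingHom.map_det s g).symm
    rw [hgs] at hd
    have hd2 : s g.det * g.det = l ^ 4 := by
      apply hdJ.mul_left_cancel
      simp only [Fintype.card_sum, Fintype.card_fin] at hd
      linear_combination hd
    obtain ⟨l, rfl⟩ := hl
    have hsl' : s (↑l⁻¹ : R) = ↑l⁻¹ := by
      have : s (↑l⁻¹ : R) * l = 1 := by
        conv_lhs => rw [← hsl, ← map_mul]
        simp
      calc s (↑l⁻¹ : R) = s (↑l⁻¹ : R) * l * ↑l⁻¹ := by simp
        _ = _ := by rw [this, one_mul]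
    have hll : (↑l⁻¹ : R) * l = 1 := by simp
    obtain ⟨α, ⟨α, rfl⟩, h⟩ := aux_unram s hs hloc θ hun (g.det * (↑l⁻¹ : R) ^ 2) (by
      rw [map_mul, map_pow, hsl']
      calc _ = (s g.det * g.det) * (↑l⁻¹ : R) ^ 4 := by ring
        _ = ((↑l⁻¹ : R) * l) ^ 4 := by rw [hd2]; ring
        _ = 1 := by rw [hll, one_pow])
    refine ⟨α, ?_⟩
    conv_rhs => rw [h]
    calc _ = ((↑l⁻¹ : R) * l) ^ 2 * (g.det * s α) := by rw [hll]; ring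
      _ = _ := by ring
  · obtain ⟨Q, hQ, hmem⟩ := exists_max_ideal_of_mem_nonunits hun
    have hsQ : ∀ x, s x - x ∈ Q := by
      intro x
      obtain ⟨c, hc⟩ := hθ x
      rw [hc]; exact Q.mul_mem_left _ hmem
    let : Field (R ⧸ Q) := Ideal.Quotient.field Q
    let φ := Ideal.Quotient.mk Q
    have hφ : ∀ x, φ (s x) = φ x := fun x => Ideal.Quotient.eq.mpr (hsQ x)
    have hφJ : (J4 R).map φ = J4 (R ⧸ Q) := by
      simp [J4, fromBlocks_map, Matrix.map_neg, Matrix.map_one]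
    have hφw : ∀ i, (sw R i).map φ = sw (R ⧸ Q) i := by
      intro i
      simp only [sw, fromBlocks_map, diagonal_map, map_zero]
      congr 2 <;> ext j <;> by_cases h : j = i <;> simp [h]
    have hφs : (g.map s).map φ = g.map φ := by ext i j; simp [hφ]
    have hφr := congrArg (fun M => M.map φ) hrel
    simp only [Matrix.map_mul, transpose_map, hφs, hφJ] at hφr
    have hφr2 : (l • J4 R).map φ = φ l • J4 (R ⧸ Q) := by
      rw [← hφJ]; ext i j; simp
    rw [hφr2] at hφr
    have hdet : ∀ M : Matrix (Fin 2 ⊕ Fin 2) (Fin 2 ⊕ Fin 2) R,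
        (M.map φ).toBlocks₁₁.det = φ M.toBlocks₁₁.det := fun M =>
      (RingHom.map_det φ M.toBlocks₁₁).symm
    have fin : ∀ M : Matrix (Fin 2 ⊕ Fin 2) (Fin 2 ⊕ Fin 2) R, M.det = g.det →
        (M.map s)ᵀ * J4 R * M = l • J4 R → (M.map φ).toBlocks₁₁.det ≠ 0 →
        ∃ α : Rˣ, g.det * s α = l ^ 2 * α := by
      intro M hM hMr hne
      have hu : IsUnit M.toBlocks₁₁.det := by
        refine aux_max s hs hloc Q hQ hsQ _ (fun h => hne ?_)
        rw [hdet]; exact Ideal.Quotient.eq_zero_iff_mem.mpr h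
      have := aux_jac s M l hl hMr
      obtain ⟨α, hα⟩ := hu
      refine ⟨α, ?_⟩
      rw [hα, ← hM, this]
    have hgφ : IsUnit (g.map φ).det := by
      have : (g.map φ).det = φ g.det := (RingHom.map_det φ g).symm
      rw [this]; exact hg.map φ
    rcases aux_field (g.map φ) hgφ (φ l) hφr with h | h | h | h
    · exact fin g rfl hrel h
    · refine fin (sw R 0 * g) (by rw [det_mul, sw_det, one_mul]) (sw_jac s 0 g l hrel) ?_
      rwa [Matrix.map_mul, hφw]
    · refine fin (sw R 1 * g) (by rw [det_mul, sw_det, one_mul]) (sw_jac s 1 g l hrel) ?_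
      rwa [Matrix.map_mul, hφw]
    · refine fin (sw R 0 * (sw R 1 * g)) (by rw [det_mul, det_mul, sw_det, sw_det, one_mul, one_mul])
        (sw_jac s 0 _ l (sw_jac s 1 g l hrel)) ?_
      rwa [Matrix.map_mul, Matrix.map_mul, hφw, hφw]
end abs

theorem aux_smul {R : Type*} [CommRing R] (l : R)
    (X M Y : Matrix (Fin 2 ⊕ Fin 2) (Fin 2 ⊕ Fin 2) R) :
    X * (l • M) * Y = l • (X * M * Y) := by
  rw [Matrix.mul_smul, Matrix.smul_mul]

section nf
theorem aux_K (K : Type*) [Field K] [NumberField K]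
    (hdeg : Module.finrank ℚ K = 2) (σK : K ≃ₐ[ℚ] K) (hσK : σK ≠ AlgEquiv.refl) :
    (∀ x, σK (σK x) = x) ∧ ∀ x, σK x = x → ∃ q : ℚ, algebraMap ℚ K q = x := by
  constructor
  · have h1 : Nat.card (K ≃ₐ[ℚ] K) ≤ 2 := by
      rw [← hdeg, Nat.card_eq_fintype_card]; exact AlgEquiv.card_le
    have : Nontrivial (K ≃ₐ[ℚ] K) := ⟨_, _, hσK⟩
    have h2 : 1 < Nat.card (K ≃ₐ[ℚ] K) := Finite.one_lt_card
    have h3 : Nat.card (K ≃ₐ[ℚ] K) = 2 := by omega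
    have h4 : σK ^ 2 = 1 := by rw [← h3]; exact pow_card_eq_one'
    intro x
    have := congrArg (fun f : K ≃ₐ[ℚ] K => f x) h4
    simpa [pow_two] using this
  · intro x hx
    let F : IntermediateField ℚ K := IntermediateField.fixedField (Subgroup.zpowers σK)
    have hmem : ∀ y, σK y = y → y ∈ F := by
      intro y hy
      rintro ⟨f, hf⟩
      have : Subgroup.zpowers σK ≤ MulAction.stabilizer (K ≃ₐ[ℚ] K) y := by
        rw [Subgroup.zpowers_le]; exact hy
      exact this hf
    have hmem' : ∀ y ∈ F, σK y = y := fun y hy => hy ⟨σK, Subgroup.mem_zpowers σK⟩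
    have hpr : (Module.finrank ℚ F) ∣ 2 := by
      rw [← hdeg]; exact ⟨_, (Module.finrank_mul_finrank ℚ F K).symm⟩
    rcases (Nat.dvd_prime Nat.prime_two).mp hpr with h | h
    · have := IntermediateField.finrank_eq_one_iff.mp h
      have hx' := hmem x hx
      rw [this] at hx'
      exact IntermediateField.mem_bot.mp hx'
    · exfalso
      have : F = ⊤ := by
        apply IntermediateField.eq_of_le_of_finrank_eq le_top
        rw [h, IntermediateField.finrank_top', hdeg]
      apply hσK
      ext y
      exact hmem' y (by rw [this]; trivial)

theorem aux_O (K : Type*) [Field K] [NumberField K]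
    (hdeg : Module.finrank ℚ K = 2)
    (σK : K ≃ₐ[ℚ] K) (hσK : σK ≠ AlgEquiv.refl)
    (σO : (𝓞 K) ≃+* (𝓞 K))
    (hcompat : ∀ x : 𝓞 K, ((σO x : K)) = σK (x : K)) :
    (∀ x, σO (σO x) = x) ∧ ∃ θ : 𝓞 K, σO θ - θ ≠ 0 ∧
      ∀ x : 𝓞 K, ∃ m n : ℤ, x = m • 1 + n • θ := by
  obtain ⟨h1, h2⟩ := aux_K K hdeg σK hσK
  refine ⟨fun x => RingOfIntegers.ext (by rw [hcompat, hcompat, h1]), ?_⟩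
  let f : 𝓞 K →ₗ[ℤ] 𝓞 K := (σO : 𝓞 K →+ 𝓞 K).toIntLinearMap - LinearMap.id
  have hf : ∀ x, f x = σO x - x := fun x => rfl
  have hk : ∀ x, f x = 0 → ∃ m : ℤ, x = m • 1 := by
    intro x hx
    rw [hf, sub_eq_zero] at hx
    obtain ⟨q, hq⟩ := h2 (x : K) (by rw [← hcompat, hx])
    have hqi : IsIntegral ℤ q := by
      have : IsIntegral ℤ (x : K) := RingOfIntegers.isIntegral_coe x
      rw [← hq] at this
      exact (isIntegral_algebraMap_iff (algebraMap ℚ K).injective).mp this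
    obtain ⟨m, hm⟩ := IsIntegrallyClosed.isIntegral_iff.mp hqi
    refine ⟨m, RingOfIntegers.ext ?_⟩
    rw [← hq, ← hm]; simp
  have hker : LinearMap.ker f = Submodule.span ℤ {1} := by
    ext x
    rw [LinearMap.mem_ker, Submodule.mem_span_singleton]
    constructor
    · intro h; obtain ⟨m, hm⟩ := hk x h; exact ⟨m, hm.symm⟩
    · rintro ⟨m, rfl⟩
      rw [hf]; simp
  have hr := f.rank_range_add_rank_ker
  have hrk : Module.finrank ℤ (LinearMap.range f) + Module.finrank ℤ (LinearMap.ker f) = 2 := by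
    rw [← hdeg, ← RingOfIntegers.rank]
    rw [← Module.finrank_eq_rank, ← Module.finrank_eq_rank, ← Module.finrank_eq_rank] at hr
    exact_mod_cast hr
  have hk1 : Module.finrank ℤ (LinearMap.ker f) ≤ 1 := by
    rw [Submodule.finrank_le_one_iff_isPrincipal, hker]; exact ⟨⟨1, rfl⟩⟩
  have hk2 : Module.finrank ℤ (LinearMap.ker f) ≠ 0 := by
    intro h
    have hb := Submodule.finrank_eq_zero.mp h
    have : (1 : 𝓞 K) ∈ LinearMap.ker f := by rw [hker]; exact Submodule.mem_span_singleton_self 1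
    rw [hb] at this
    exact one_ne_zero ((Submodule.mem_bot ℤ).mp this)
  have hr1 : Module.finrank ℤ (LinearMap.range f) = 1 := by omega
  obtain ⟨⟨d, hd⟩⟩ := (Submodule.finrank_le_one_iff_isPrincipal _).mp hr1.le
  have hdm : d ∈ LinearMap.range f := by rw [hd]; exact Submodule.mem_span_singleton_self d
  obtain ⟨θ, rfl⟩ := hdm
  refine ⟨θ, ?_, ?_⟩
  · intro h0
    rw [← hf] at h0
    rw [h0, Submodule.span_zero_singleton] at hd
    rw [hd] at hr1; simp at hr1
  · intro x
    have : f x ∈ LinearMap.range f := ⟨x, rfl⟩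
    rw [hd, Submodule.mem_span_singleton] at this
    obtain ⟨n, hn⟩ := this
    obtain ⟨m, hm⟩ := hk (x - n • θ) (by rw [map_sub, map_smul, hn, sub_self])
    exact ⟨m, n, by rw [← hm]; ring⟩

theorem aux_R (K : Type*) [Field K] [NumberField K]
    (hdeg : Module.finrank ℚ K = 2)
    (σK : K ≃ₐ[ℚ] K) (hσK : σK ≠ AlgEquiv.refl)
    (σO : (𝓞 K) ≃+* (𝓞 K))
    (hcompat : ∀ x : 𝓞 K, ((σO x : K)) = σK (x : K)) (p : ℕ) [Fact p.Prime] :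
    (∀ x, sigmaR K σO p (sigmaR K σO p x) = x) ∧
    (∀ x y, sigmaR K σO p x = x → sigmaR K σO p y = y → IsUnit (x + y) → IsUnit x ∨ IsUnit y) ∧
    (∃ θ, ∀ x, ∃ c, sigmaR K σO p x - x = c * (sigmaR K σO p θ - θ)) := by
  obtain ⟨h1, θ, hθ, hb⟩ := aux_O K hdeg σK hσK σO hcompat
  have hst : ∀ (x : 𝓞 K) (a : ℤ_[p]), sigmaR K σO p (x ⊗ₜ a) = σO x ⊗ₜ a := fun x a => rfl
  have hdec : ∀ x : (𝓞 K) ⊗[ℤ] ℤ_[p], ∃ a b : ℤ_[p], x = 1 ⊗ₜ a + θ ⊗ₜ b := by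
    intro x
    induction x with
    | zero => exact ⟨0, 0, by simp⟩
    | tmul x a =>
      obtain ⟨m, n, rfl⟩ := hb x
      exact ⟨m • a, n • a, by rw [TensorProduct.add_tmul, TensorProduct.smul_tmul, TensorProduct.smul_tmul]⟩
    | add x y hx hy =>
      obtain ⟨a, b, rfl⟩ := hx
      obtain ⟨c, d, rfl⟩ := hy
      exact ⟨a + c, b + d, by rw [TensorProduct.tmul_add, TensorProduct.tmul_add]; abel⟩
  have hsub : ∀ a b : ℤ_[p], sigmaR K σO p (1 ⊗ₜ a + θ ⊗ₜ b) - (1 ⊗ₜ a + θ ⊗ₜ b) =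
      (σO θ - θ) ⊗ₜ b := by
    intro a b
    rw [map_add, hst, hst, map_one, TensorProduct.sub_tmul]; abel
  have hinj : ∀ d : 𝓞 K, d ≠ 0 → ∀ b : ℤ_[p], d ⊗ₜ[ℤ] b = 0 → b = 0 := by
    intro d hd b h0
    have := Module.Flat.rTensor_preserves_injective_linearMap (M := ℤ_[p])
      (LinearMap.toSpanSingleton ℤ (𝓞 K) d) (by
        intro m n h
        simpa [hd] using h)
    have h2 : (1 : ℤ) ⊗ₜ[ℤ] b = 0 := this (by simpa using h0)
    have := congrArg (TensorProduct.lid ℤ ℤ_[p]) h2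
    simpa using this
  have hfix : ∀ x, sigmaR K σO p x = x → ∃ a : ℤ_[p], x = iotaR K p a := by
    intro x hx
    obtain ⟨a, b, rfl⟩ := hdec x
    have := hsub a b
    rw [hx, sub_self] at this
    have := hinj _ hθ b this.symm
    exact ⟨a, by rw [this]; simp [iotaR]⟩
  have hs : ∀ x, sigmaR K σO p (sigmaR K σO p x) = x := by
    intro x
    obtain ⟨a, b, rfl⟩ := hdec x
    simp only [map_add, hst, h1]
  have hιs : ∀ a, sigmaR K σO p (iotaR K p a) = iotaR K p a := by
    intro a
    change sigmaR K σO p (1 ⊗ₜ a) = 1 ⊗ₜ a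
    rw [hst, map_one]
  have hιu : ∀ a, IsUnit (iotaR K p a) → IsUnit a := by
    intro a ha
    obtain ⟨w, hw⟩ := ha.exists_right_inv
    have hsw : sigmaR K σO p w = w := by
      have h3 := congrArg (sigmaR K σO p) hw
      rw [map_mul, hιs, map_one] at h3
      exact ha.mul_left_cancel (h3.trans hw.symm)
    obtain ⟨c, rfl⟩ := hfix w hsw
    refine IsUnit.of_mul_eq_one c ?_
    rw [← sub_eq_zero]
    refine hinj 1 one_ne_zero _ ?_
    change iotaR K p (a * c - 1) = 0
    rw [map_sub, map_mul, map_one, hw, sub_self]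
  refine ⟨hs, ?_, θ ⊗ₜ 1, ?_⟩
  · intro x y hx hy hxy
    obtain ⟨a, rfl⟩ := hfix x hx
    obtain ⟨b, rfl⟩ := hfix y hy
    rw [← map_add] at hxy
    exact (IsLocalRing.isUnit_or_isUnit_of_isUnit_add (hιu _ hxy)).imp
      (fun h => h.map _) (fun h => h.map _)
  · intro x
    obtain ⟨a, b, rfl⟩ := hdec x
    refine ⟨1 ⊗ₜ b, ?_⟩
    rw [hsub, hst, ← TensorProduct.sub_tmul, Algebra.TensorProduct.tmul_mul_tmul, one_mul, mul_one]
end nf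

/-- Let `R = 𝓞 ⊗_ℤ ℤ_p` with involution `σ_R = σ ⊗ id`.  If `g` is
an invertible 4×4 matrix over `R` with `σ_R(g)ᵀ J g = λ J` for a unit `λ` of `ℤ_p`,
then `g = h · r_α` with `σ_R(h)ᵀ J h = μ J`, `det h = μ²` for a unit `μ` of `ℤ_p` and
`α ∈ R^×`; equivalently `det(g)/λ² = α σ_R(α)⁻¹` for some `α ∈ R^×`. -/
theorem stmt7 (K : Type*) [Field K] [NumberField K]
    (hdeg : Module.finrank ℚ K = 2) (hdisc : NumberField.discr K < 0)
    (σK : K ≃ₐ[ℚ] K) (hσK : σK ≠ AlgEquiv.refl)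
    (σO : (𝓞 K) ≃+* (𝓞 K))
    (hcompat : ∀ x : 𝓞 K, ((σO x : K)) = σK (x : K))
    (p : ℕ) [Fact p.Prime]
    (g : Matrix (Fin 2 ⊕ Fin 2) (Fin 2 ⊕ Fin 2) ((𝓞 K) ⊗[ℤ] ℤ_[p]))
    (hg : IsUnit g.det)
    (lam : ℤ_[p]ˣ)
    (hrel : (g.map (fun x => sigmaR K σO p x))ᵀ *
        J4 ((𝓞 K) ⊗[ℤ] ℤ_[p]) * g =
      iotaR K p (lam : ℤ_[p]) • J4 ((𝓞 K) ⊗[ℤ] ℤ_[p])) :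
    (∃ (h : Matrix (Fin 2 ⊕ Fin 2) (Fin 2 ⊕ Fin 2) ((𝓞 K) ⊗[ℤ] ℤ_[p]))
        (μ : ℤ_[p]ˣ) (α : ((𝓞 K) ⊗[ℤ] ℤ_[p])ˣ),
      IsUnit h.det ∧
      (h.map (fun x => sigmaR K σO p x))ᵀ * J4 ((𝓞 K) ⊗[ℤ] ℤ_[p]) * h =
        iotaR K p (μ : ℤ_[p]) • J4 ((𝓞 K) ⊗[ℤ] ℤ_[p]) ∧
      h.det = iotaR K p (μ : ℤ_[p]) ^ 2 ∧
      g = h * rAlpha K σO p α) ∧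
    (∃ α : ((𝓞 K) ⊗[ℤ] ℤ_[p])ˣ,
      g.det * sigmaR K σO p (α : (𝓞 K) ⊗[ℤ] ℤ_[p]) =
        iotaR K p (lam : ℤ_[p]) ^ 2 * (α : (𝓞 K) ⊗[ℤ] ℤ_[p])) := by
  obtain ⟨hs, hloc, θ, hθ⟩ := aux_R K hdeg σK hσK σO hcompat p
  have hιs : ∀ a, sigmaR K σO p (iotaR K p a) = iotaR K p a := by
    intro a
    change sigmaR K σO p (1 ⊗ₜ a) = 1 ⊗ₜ a
    change (σO 1) ⊗ₜ a = 1 ⊗ₜ a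
    rw [map_one]
  have hl : IsUnit (iotaR K p (lam : ℤ_[p])) := lam.isUnit.map _
  obtain ⟨α, hα⟩ := aux_main (sigmaR K σO p : (𝓞 K) ⊗[ℤ] ℤ_[p] →+* (𝓞 K) ⊗[ℤ] ℤ_[p])
    hs hloc θ hθ g hg _ hl (hιs _) hrel
  change g.det * sigmaR K σO p α = _ at hα
  refine ⟨?_, α, hα⟩
  generalize hS : sigmaR K σO p = S at *
  have hS1 : ∀ β : ((𝓞 K) ⊗[ℤ] ℤ_[p])ˣ, S β * S (β⁻¹ : ((𝓞 K) ⊗[ℤ] ℤ_[p])ˣ) = 1 := by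
    intro β
    rw [← map_mul, Units.mul_inv, map_one]
  have hS2 : ∀ β : ((𝓞 K) ⊗[ℤ] ℤ_[p])ˣ, S (β⁻¹ : ((𝓞 K) ⊗[ℤ] ℤ_[p])ˣ) * S β = 1 := by
    intro β
    rw [← map_mul, Units.inv_mul, map_one]
  have hr1 : rAlpha K σO p α⁻¹ * rAlpha K σO p α = 1 := by
    simp only [rAlpha, hS, fromBlocks_multiply, ← fromBlocks_one, diagonal_mul_diagonal,
      ← diagonal_one, ← diagonal_zero, diagonal_add]
    congr 1 <;> · ext j k; fin_cases j <;> fin_cases k <;> simp [hS1]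
  have hrd : (rAlpha K σO p α⁻¹).det = ↑α⁻¹ * S α := by
    simp [rAlpha, hS, det_fromBlocks_zero₂₁, det_diagonal]
  have hrr : ((rAlpha K σO p α⁻¹).map (fun x => S x))ᵀ * J4 ((𝓞 K) ⊗[ℤ] ℤ_[p]) *
      rAlpha K σO p α⁻¹ = J4 ((𝓞 K) ⊗[ℤ] ℤ_[p]) := by
    simp only [rAlpha, J4, hS, fromBlocks_map, fromBlocks_transpose, fromBlocks_multiply]
    congr 1 <;> · ext j k; fin_cases j <;> fin_cases k <;> simp [hS1, hS2, hs, neg_mul (S (α⁻¹ : ((𝓞 K) ⊗[ℤ] ℤ_[p])ˣ))]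
  have hdet : (g * rAlpha K σO p α⁻¹).det = iotaR K p (lam : ℤ_[p]) ^ 2 := by
    rw [det_mul, hrd]
    calc _ = (g.det * S α) * ↑α⁻¹ := by ring
      _ = _ := by rw [hα, mul_assoc, Units.mul_inv, mul_one]
  refine ⟨g * rAlpha K σO p α⁻¹, lam, α, ?_, ?_, hdet, ?_⟩
  · rw [hdet]; exact hl.pow 2
  · have : (g * rAlpha K σO p α⁻¹).map (fun x => S x) =
        g.map (fun x => S x) * (rAlpha K σO p α⁻¹).map (fun x => S x) :=
      Matrix.map_mul (f := (S : (𝓞 K) ⊗[ℤ] ℤ_[p] →+* (𝓞 K) ⊗[ℤ] ℤ_[p]))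
    rw [this, transpose_mul]
    conv_rhs => rw [← hrr]
    calc _ = ((rAlpha K σO p α⁻¹).map (fun x => S x))ᵀ *
          ((g.map (fun x => S x))ᵀ * J4 ((𝓞 K) ⊗[ℤ] ℤ_[p]) * g) * rAlpha K σO p α⁻¹ := by
            simp only [mul_assoc]
      _ = _ := by rw [hrel]; exact aux_smul _ _ _ _
  · rw [mul_assoc, hr1, mul_one]

end
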